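/- There exist pure-point measures σ and Σ on ℝ, both with locally finite support, such that: (a) Σ is a translation-bounded measure, and hence a strongly tempered measure; (b) σ is a tempered measure but not a strongly tempered measure; (c) σ̂ = Σ as tempered distributions; (d) σ is strongly almost periodic as a tempered distribution, in particular translation bounded as a tempered distribution; (e) Σ is a norm almost periodic measure, in particular strongly almost periodic both as a tempered distribution and as a measure. In particular, σ is a crystalline measure that is not a Fourier quasicrystal. -/

import Mathlib

set_option linter.unusedSectionVars false

open MeasureTheory Filter Metric Complex SchwartzMap
open scoped Topology ENNReal NNReal ComplexConjugate

noncomputable section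

section Preamble

variable {E : Type*} [NormedAddCommGroup E] [InnerProductSpace ℝ E] [FiniteDimensional ℝ E]
  [MeasurableSpace E] [BorelSpace E]

/-- A set is relatively dense if it has bounded gaps. -/
def IsRelativelyDense (A : Set E) : Prop :=
  ∃ r : ℝ, ∀ x : E, ∃ a ∈ A, dist x a ≤ r

/-- Bohr almost periodic functions: uniformly continuous, bounded, with relatively
dense sets of ε-almost periods. -/
def IsBohrAP (f : E → ℂ) : Prop :=
  UniformContinuous f ∧ (∃ C : ℝ, ∀ x, ‖f x‖ ≤ C) ∧
    ∀ ε : ℝ, 0 < ε → IsRelativelyDense {t : E | ∀ x, ‖f (x - t) - f x‖ < ε}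

/-- Bounded functions. -/
def IsBddFun (f : E → ℂ) : Prop := ∃ C : ℝ, ∀ x, ‖f x‖ ≤ C

lemma isometry_const_sub (x : E) : Isometry (fun y : E => x - y) :=
  Isometry.of_dist_eq (fun a b => dist_sub_left x a b)

lemma hasTemperateGrowth_const_sub (x : E) :
    Function.HasTemperateGrowth (fun y : E => x - y) := by
  apply Function.HasTemperateGrowth.of_fderiv (k := 1) (C := ‖x‖ + 1)
  · have h : (fderiv ℝ (fun y : E => x - y)) =
        fun _ : E => ((0 : E →L[ℝ] E) - ContinuousLinearMap.id ℝ E) := by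
      funext y
      exact ((hasFDerivAt_const x y).sub (hasFDerivAt_id y)).fderiv
    rw [h]
    exact Function.HasTemperateGrowth.const _
  · exact (differentiable_const x).sub differentiable_id
  · intro y
    have h1 : ‖x - y‖ ≤ ‖x‖ + ‖y‖ := norm_sub_le x y
    have h2 : (0:ℝ) ≤ ‖x‖ := norm_nonneg x
    have h3 : (0:ℝ) ≤ ‖y‖ := norm_nonneg y
    calc ‖x - y‖ ≤ ‖x‖ + ‖y‖ := h1
      _ ≤ (‖x‖ + 1) * (1 + ‖y‖) ^ 1 := by nlinarith

/-- The reflected translate `y ↦ ψ (x - y)` of a Schwartz function. -/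
def transRefl (x : E) (ψ : SchwartzMap E ℂ) : SchwartzMap E ℂ :=
  SchwartzMap.compCLMOfAntilipschitz (K := 1) ℝ (hasTemperateGrowth_const_sub x)
    (isometry_const_sub x).antilipschitz ψ

@[simp] lemma transRefl_apply (x : E) (ψ : SchwartzMap E ℂ) (y : E) :
    transRefl x ψ y = ψ (x - y) := rfl

/-- Convolution of a tempered distribution with a Schwartz function:
`(T * ψ)(x) = T (ψ (x - ·))`. -/
def convTD (T : SchwartzMap E ℂ →L[ℂ] ℂ) (ψ : SchwartzMap E ℂ) : E → ℂ :=
  fun x => T (transRefl x ψ)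

/-- Smooth compactly supported test function, regarded inside the Schwartz space. -/
def IsTestFn (φ : SchwartzMap E ℂ) : Prop := HasCompactSupport ⇑φ

/-- Translation bounded as a tempered distribution. -/
def TransBddTD (T : SchwartzMap E ℂ →L[ℂ] ℂ) : Prop :=
  ∀ ψ : SchwartzMap E ℂ, IsBddFun (convTD T ψ)

/-- Translation bounded as a distribution. -/
def TransBddD (T : SchwartzMap E ℂ →L[ℂ] ℂ) : Prop :=
  ∀ ψ : SchwartzMap E ℂ, IsTestFn ψ → IsBddFun (convTD T ψ)

/-- Strongly almost periodic as a tempered distribution. -/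
def SAPTD (T : SchwartzMap E ℂ →L[ℂ] ℂ) : Prop :=
  ∀ ψ : SchwartzMap E ℂ, IsBohrAP (convTD T ψ)

/-- Strongly almost periodic as a distribution. -/
def SAPD (T : SchwartzMap E ℂ →L[ℂ] ℂ) : Prop :=
  ∀ ψ : SchwartzMap E ℂ, IsTestFn ψ → IsBohrAP (convTD T ψ)

/-- The distributional Fourier transform, `T̂(φ) = T(φ̂)`, with the convention
`φ̂(ξ) = ∫ e^{-2πi⟨x,ξ⟩} φ(x) dx`. -/
def fourierTD (T : SchwartzMap E ℂ →L[ℂ] ℂ) : SchwartzMap E ℂ →L[ℂ] ℂ :=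
  T.comp (SchwartzMap.fourierTransformCLM ℂ)

/-- A complex Radon measure, encoded by its total variation measure together with a
unimodular density (polar decomposition). -/
structure CMeasure (E : Type*) [TopologicalSpace E] [MeasurableSpace E] where
  /-- the total variation measure -/
  tv : Measure E
  locFin : IsLocallyFiniteMeasure tv
  /-- the unimodular density -/
  density : E → ℂ
  density_meas : Measurable density
  density_norm : ∀ᵐ x ∂tv, ‖density x‖ = 1

namespace CMeasure

/-- Pairing of a complex measure with a function: `μ(φ) = ∫ φ dμ`. -/
def pairing (μ : CMeasure E) (φ : E → ℂ) : ℂ := ∫ x, φ x * μ.density x ∂μ.tv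

/-- The complex measure agrees with the tempered distribution `T` on all smooth
compactly supported test functions; i.e. `μ` is a tempered measure identified with `T`. -/
def Agrees (μ : CMeasure E) (T : SchwartzMap E ℂ →L[ℂ] ℂ) : Prop :=
  ∀ φ : SchwartzMap E ℂ, IsTestFn φ → T φ = μ.pairing ⇑φ

/-- A tempered measure is one that extends to a tempered distribution. -/
def IsTempered (μ : CMeasure E) : Prop := ∃ T, μ.Agrees T

/-- Pure point measure: concentrated on a countable set. -/
def IsPurePoint (μ : CMeasure E) : Prop := ∃ S : Set E, S.Countable ∧ μ.tv Sᶜ = 0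

/-- Convolution of a complex measure with a function: `(μ * φ)(x) = ∫ φ(x - y) dμ(y)`. -/
def convM (μ : CMeasure E) (φ : E → ℂ) : E → ℂ :=
  fun x => ∫ y, φ (x - y) * μ.density y ∂μ.tv

/-- Translation bounded as a measure. -/
def TransBddM (μ : CMeasure E) : Prop :=
  ∀ φ : E → ℂ, Continuous φ → HasCompactSupport φ → IsBddFun (μ.convM φ)

/-- Strongly almost periodic as a measure. -/
def SAPM (μ : CMeasure E) : Prop :=
  ∀ φ : E → ℂ, Continuous φ → HasCompactSupport φ → IsBohrAP (μ.convM φ)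

/-- Strongly tempered measure: the total variation has polynomial growth,
equivalently `|μ|` is a tempered (slowly increasing) measure. -/
def IsStronglyTempered (μ : CMeasure E) : Prop :=
  ∃ C a : ℝ, ∀ r : ℝ, 1 ≤ r → μ.tv (Metric.closedBall 0 r) ≤ ENNReal.ofReal (C * r ^ a)

/-- The atom of a complex measure at a point: `μ({x})`. -/
def atom (μ : CMeasure E) (x : E) : ℂ := (μ.tv {x}).toReal • μ.density x

/-- The measure is concentrated on a locally finite set. -/
def LocallyFiniteSupport (μ : CMeasure E) : Prop :=
  ∃ S : Set E, (∀ K : Set E, IsCompact K → (S ∩ K).Finite) ∧ μ.tv Sᶜ = 0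

end CMeasure

end Preamble

section RS

lemma rs_exists (k : ℕ) : ∃ p r : ℕ → ℂ, (∀ i, ‖p i‖ = 1) ∧ (∀ i, ‖r i‖ = 1) ∧
    ∀ z : ℂ, ‖z‖ = 1 → ‖∑ i ∈ Finset.range (2 ^ k), p i * z ^ i‖ ^ 2
      + ‖∑ i ∈ Finset.range (2 ^ k), r i * z ^ i‖ ^ 2 = 2 ^ (k + 1) := by
  induction k with
  | zero => exact ⟨fun _ => 1, fun _ => 1, by simp, by simp, by intro z hz; norm_num⟩
  | succ k ih =>
    obtain ⟨p, r, hp, hr, h⟩ := ih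
    refine ⟨fun i => if i < 2 ^ k then p i else r (i - 2 ^ k),
      fun i => if i < 2 ^ k then p i else - r (i - 2 ^ k), ?_, ?_, ?_⟩
    · intro i; dsimp only; split_ifs <;> simp [hp, hr]
    · intro i; dsimp only; split_ifs <;> simp [hp, hr]
    · intro z hz
      have e1 : (2:ℕ) ^ (k + 1) = 2 ^ k + 2 ^ k := by ring
      rw [e1, Finset.sum_range_add, Finset.sum_range_add]
      have h1 : ∑ x ∈ Finset.range (2 ^ k), (if x < 2 ^ k then p x else r (x - 2 ^ k)) * z ^ x
          = ∑ i ∈ Finset.range (2 ^ k), p i * z ^ i :=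
        Finset.sum_congr rfl fun x hx => by rw [if_pos (Finset.mem_range.1 hx)]
      have h2 : ∑ x ∈ Finset.range (2 ^ k), (if x < 2 ^ k then p x else - r (x - 2 ^ k)) * z ^ x
          = ∑ i ∈ Finset.range (2 ^ k), p i * z ^ i :=
        Finset.sum_congr rfl fun x hx => by rw [if_pos (Finset.mem_range.1 hx)]
      have h3 : ∑ x ∈ Finset.range (2 ^ k), (if 2 ^ k + x < 2 ^ k then p (2 ^ k + x)
          else r (2 ^ k + x - 2 ^ k)) * z ^ (2 ^ k + x)
          = z ^ (2 ^ k) * ∑ i ∈ Finset.range (2 ^ k), r i * z ^ i := by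
        rw [Finset.mul_sum]
        refine Finset.sum_congr rfl fun x hx => ?_
        rw [if_neg (by omega), Nat.add_sub_cancel_left]; ring
      have h4 : ∑ x ∈ Finset.range (2 ^ k), (if 2 ^ k + x < 2 ^ k then p (2 ^ k + x)
          else - r (2 ^ k + x - 2 ^ k)) * z ^ (2 ^ k + x)
          = - (z ^ (2 ^ k) * ∑ i ∈ Finset.range (2 ^ k), r i * z ^ i) := by
        rw [Finset.mul_sum, ← Finset.sum_neg_distrib]
        refine Finset.sum_congr rfl fun x hx => ?_
        rw [if_neg (by omega), Nat.add_sub_cancel_left]; ring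
      rw [h1, h2, h3, h4, ← sub_eq_add_neg]
      have := parallelogram_law_with_norm ℝ (∑ i ∈ Finset.range (2 ^ k), p i * z ^ i)
        (z ^ (2 ^ k) * ∑ i ∈ Finset.range (2 ^ k), r i * z ^ i)
      have h5 : ‖z ^ (2 ^ k) * ∑ i ∈ Finset.range (2 ^ k), r i * z ^ i‖
        = ‖∑ i ∈ Finset.range (2 ^ k), r i * z ^ i‖ := by
        rw [norm_mul, norm_pow, hz, one_pow, one_mul]
      have h6 := h z hz
      rw [h5] at this
      rw [pow_succ 2 (k+1), ← h6]
      nlinarith [this]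

lemma sum_range_mul_aux (F : ℕ → ℂ) (M K : ℕ) : ∑ i ∈ Finset.range (K * M), F i
    = ∑ a ∈ Finset.range K, ∑ b ∈ Finset.range M, F (a * M + b) := by
  induction K with
  | zero => simp
  | succ K ih => rw [Nat.succ_mul, Finset.sum_range_add, ih, Finset.sum_range_succ]

/-- `e(t) = exp(2 π i t)` -/
def ee (t : ℝ) : ℂ := Complex.exp (2 * Real.pi * I * t)

lemma ee_add (s t : ℝ) : ee (s + t) = ee s * ee t := by
  unfold ee; rw [← Complex.exp_add]; push_cast; ring_nf

lemma ee_int (n : ℤ) : ee n = 1 := by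
  unfold ee; rw [Complex.exp_eq_one_iff]; exact ⟨n, by push_cast; ring⟩

lemma ee_zero : ee 0 = 1 := by simp [ee]

lemma norm_ee (t : ℝ) : ‖ee t‖ = 1 := by
  unfold ee
  have : (2 * Real.pi * I * t : ℂ) = ((2 * Real.pi * t : ℝ) : ℂ) * I := by push_cast; ring
  rw [this, Complex.norm_exp_ofReal_mul_I]

lemma ee_pow (t : ℝ) (n : ℕ) : ee t ^ n = ee (n * t) := by
  unfold ee; rw [← Complex.exp_nat_mul]; push_cast; ring_nf

lemma continuous_ee : Continuous ee := by unfold ee; fun_prop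

lemma w_exists (J P : ℕ) (A : ℝ) : ∃ q : ℕ, 0 < q ∧ ∃ w : ℕ → ℂ,
    (∀ j : ℤ, ‖∑ i ∈ Finset.range q, w i * ee (-(i * j / (q * P) : ℝ))‖ ≤ 1) ∧
    (∀ j : ℤ, |j| ≤ J → ∑ i ∈ Finset.range q, w i * ee (-(i * j / (q * P) : ℝ)) = 0) ∧
    A ≤ ∑ i ∈ Finset.range q, ‖w i‖ := by
  obtain ⟨a, ha⟩ := pow_unbounded_of_one_lt A (one_lt_two)
  set c : ℕ := (Finset.Icc (-(J:ℤ)) J).card with hc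
  set m := c + a with hm
  obtain ⟨p, r, hp, hr, h⟩ := rs_exists (2 * m + 1)
  set K := 2 ^ (2 * m + 1) with hK
  set M := c + 1 with hM
  set q := K * M with hq
  have hqpos : 0 < q := by positivity
  let V : Polynomial ℂ := ∏ l ∈ Finset.Icc (-(J:ℤ)) J,
    (1 - Polynomial.C (ee (l / (q * P))) * Polynomial.X)
  have hVdeg : V.natDegree < M := by
    refine lt_of_le_of_lt (Polynomial.natDegree_prod_le _ _) ?_
    have : ∀ l ∈ Finset.Icc (-(J:ℤ)) J, (1 - Polynomial.C (ee (l / (q * P)))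
        * Polynomial.X : Polynomial ℂ).natDegree ≤ 1 := by
      intro l _
      compute_degree
    have := Finset.sum_le_sum this
    simp only [Finset.sum_const, smul_eq_mul, mul_one] at this
    omega
  have hV0 : V.coeff 0 = 1 := by
    rw [Polynomial.coeff_zero_eq_eval_zero, Polynomial.eval_prod]
    simp
  have hVn : ∀ z : ℂ, ‖z‖ = 1 → ‖V.eval z‖ ≤ 2 ^ c := by
    intro z hz
    rw [Polynomial.eval_prod, norm_prod]
    calc _ ≤ ∏ l ∈ Finset.Icc (-(J:ℤ)) J, (2:ℝ) := by
          refine Finset.prod_le_prod (fun _ _ => norm_nonneg _) fun l _ => ?_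
          simp only [Polynomial.eval_sub, Polynomial.eval_one, Polynomial.eval_mul,
            Polynomial.eval_C, Polynomial.eval_X]
          refine (norm_sub_le _ _).trans ?_
          rw [norm_mul, norm_ee, hz]; norm_num
      _ = _ := by simp [hc]
  have key : ∀ z : ℂ, ∑ i ∈ Finset.range q, (p (i / M) * V.coeff (i % M)) * z ^ i
      = (∑ i ∈ Finset.range K, p i * (z ^ M) ^ i) * V.eval z := by
    intro z
    rw [hq, sum_range_mul_aux, Finset.sum_mul]
    refine Finset.sum_congr rfl fun x hx => ?_
    rw [Polynomial.eval_eq_sum_range' hVdeg, Finset.mul_sum]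
    refine Finset.sum_congr rfl fun y hy => ?_
    have hy := Finset.mem_range.1 hy
    have e1 : (x * M + y) / M = x := by
      rw [mul_comm, Nat.mul_add_div (by omega), Nat.div_eq_of_lt hy, add_zero]
    have e2 : (x * M + y) % M = y := by
      rw [mul_comm, Nat.mul_add_mod, Nat.mod_eq_of_lt hy]
    rw [e1, e2, pow_add, ← pow_mul, mul_comm M x]; ring
  have ez : ∀ (i : ℕ) (j : ℤ), ee (-(i * j / (q * P) : ℝ)) = ee (-(j / (q * P) : ℝ)) ^ i := by
    intro i j; rw [ee_pow]; congr 1; ring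
  refine ⟨q, hqpos, fun i => ((2:ℂ) ^ (m + 1) * 2 ^ c)⁻¹ * (p (i / M) * V.coeff (i % M)),
    ?_, ?_, ?_⟩
  · intro j
    simp only [ez, mul_assoc (((2:ℂ) ^ (m + 1) * 2 ^ c)⁻¹)]
    rw [← Finset.mul_sum, key, norm_mul, norm_mul]
    set z := ee (-(j / (q * P) : ℝ))
    have hz : ‖z‖ = 1 := norm_ee _
    have h1 := hVn z hz
    have h2 := h (z ^ M) (by rw [norm_pow, hz, one_pow])
    have h3 : ‖∑ i ∈ Finset.range K, p i * (z ^ M) ^ i‖ ≤ 2 ^ (m + 1) := by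
      refine le_of_sq_le_sq ?_ (by positivity)
      have : ((2:ℝ) ^ (m + 1)) ^ 2 = 2 ^ (2 * m + 1 + 1) := by rw [← pow_mul]; congr 1; ring
      rw [this, ← h2]
      have := sq_nonneg ‖∑ i ∈ Finset.range K, r i * (z ^ M) ^ i‖
      linarith
    rw [norm_inv, norm_mul, norm_pow, norm_pow, Complex.norm_ofNat, inv_mul_le_iff₀ (by positivity),
      mul_one]
    gcongr
  · intro j hj
    simp only [ez, mul_assoc (((2:ℂ) ^ (m + 1) * 2 ^ c)⁻¹)]
    rw [← Finset.mul_sum, key]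
    have : V.eval (ee (-(j / (q * P) : ℝ))) = 0 := by
      rw [Polynomial.eval_prod]
      refine Finset.prod_eq_zero (i := j) (Finset.mem_Icc.2 (abs_le.1 hj)) ?_
      simp only [Polynomial.eval_sub, Polynomial.eval_one, Polynomial.eval_mul,
            Polynomial.eval_C, Polynomial.eval_X]
      rw [← ee_add, add_neg_cancel, ee_zero, sub_self]
    rw [this, mul_zero, mul_zero]
  · have hle : ∀ x ∈ Finset.range K, ((2:ℝ) ^ (m + 1) * 2 ^ c)⁻¹ ≤
        ∑ b ∈ Finset.range M, ‖((2:ℂ) ^ (m + 1) * 2 ^ c)⁻¹ *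
          (p ((x * M + b) / M) * V.coeff ((x * M + b) % M))‖ := by
      intro x hx
      refine le_trans ?_ (Finset.single_le_sum (fun _ _ => norm_nonneg _)
        (Finset.mem_range.2 (show 0 < M by omega)))
      simp [hV0, hp]
    have h1 := Finset.sum_le_sum hle
    have h2 : ∑ i ∈ Finset.range q, ‖((2:ℂ) ^ (m + 1) * 2 ^ c)⁻¹ *
          (p (i / M) * V.coeff (i % M))‖ = ∑ x ∈ Finset.range K,
        ∑ b ∈ Finset.range M, ‖((2:ℂ) ^ (m + 1) * 2 ^ c)⁻¹ *
          (p ((x * M + b) / M) * V.coeff ((x * M + b) % M))‖ := by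
      have := sum_range_mul_aux (fun i => ((‖((2:ℂ) ^ (m + 1) * 2 ^ c)⁻¹ *
          (p (i / M) * V.coeff (i % M))‖ : ℝ) : ℂ)) M K
      exact_mod_cast this
    rw [h2]
    refine le_trans ?_ h1
    rw [Finset.sum_const, Finset.card_range, nsmul_eq_mul, hK]
    refine ha.le.trans (le_of_eq ?_)
    push_cast
    rw [hm, eq_comm, mul_inv_eq_iff_eq_mul₀ (by positivity)]
    ring

end RS

section MK

/-- locally finite support -/
def LF (g : ℝ → ℂ) : Prop := ∀ K : Set ℝ, IsCompact K → (Function.support g ∩ K).Finite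

lemma LF.countable {g : ℝ → ℂ} (hg : LF g) : (Function.support g).Countable := by
  have : Function.support g = ⋃ n : ℕ, (Function.support g ∩ Metric.closedBall 0 n) := by
    rw [← Set.inter_iUnion, Metric.iUnion_closedBall_nat, Set.inter_univ]
  rw [this]
  exact Set.countable_iUnion fun n => (hg _ (isCompact_closedBall 0 _)).countable

/-- the total variation measure of an atomic measure -/
def tvM (g : ℝ → ℂ) : Measure ℝ :=
  Measure.sum (fun x : Function.support g => ‖g x‖ₑ • Measure.dirac (x : ℝ))

lemma tvM_apply (g : ℝ → ℂ) {A : Set ℝ} (hA : MeasurableSet A) :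
    tvM g A = ∑' x : A, ‖g x‖ₑ := by
  unfold tvM
  rw [Measure.sum_apply _ hA, tsum_subtype A (fun x => ‖g x‖ₑ),
    ← tsum_subtype_eq_of_support_subset (s := Function.support g)]
  · refine tsum_congr fun x => ?_
    rw [Measure.smul_apply, Measure.dirac_apply' _ hA, smul_eq_mul]
    by_cases h : (x : ℝ) ∈ A <;> simp [h]
  · intro x hx
    contrapose! hx
    simp only [Function.mem_support, not_not] at hx ⊢
    by_cases h : (x : ℝ) ∈ A <;> simp [h, hx]

lemma tvM_compl (g : ℝ → ℂ) (hg : LF g) : tvM g (Function.support g)ᶜ = 0 := by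
  rw [tvM_apply g hg.countable.measurableSet.compl, ENNReal.tsum_eq_zero]
  rintro ⟨x, hx⟩
  simpa using hx

/-- density -/
def densM (g : ℝ → ℂ) (x : ℝ) : ℂ := if g x = 0 then 1 else g x / ‖g x‖

/-- the measure with atoms `g` -/
def mkM (g : ℝ → ℂ) (hg : LF g) : CMeasure ℝ where
  tv := tvM g
  locFin := by
    refine ⟨fun x => ⟨Metric.closedBall x 1, Metric.closedBall_mem_nhds x one_pos, ?_⟩⟩
    rw [tvM_apply g Metric.isClosed_closedBall.measurableSet, tsum_subtype _ (fun x => ‖g x‖ₑ)]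
    have hf := hg _ (isCompact_closedBall x 1)
    rw [tsum_eq_sum (s := hf.toFinset)]
    · refine ENNReal.sum_lt_top.2 fun y _ => ?_
      by_cases h : y ∈ closedBall x 1 <;> simp [h]
    · intro y hy
      simp only [Set.Finite.mem_toFinset, Set.mem_inter_iff, Function.mem_support, not_and] at hy
      by_cases h : y ∈ closedBall x 1
      · have : g y = 0 := by by_contra h'; exact hy h' h
        simp [this]
      · simp [h]
  density := densM g
  density_meas := by
    refine (measurable_const (a := (1:ℂ))).measurable_of_countable_ne (hg.countable.mono ?_)
    intro x hx
    contrapose! hx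
    simp only [Function.mem_support, not_not] at hx
    simp [densM, hx]
  density_norm := by
    refine Filter.Eventually.of_forall fun x => ?_
    unfold densM
    split_ifs with h
    · simp
    · simp [h]

variable {g : ℝ → ℂ} (hg : LF g)

lemma mkM_integral (φ : ℝ → ℂ) : ∫ x, φ x * (mkM g hg).density x ∂(mkM g hg).tv
    = ∑' x, φ x * g x := by
  have : Countable (Function.support g) := hg.countable.to_subtype
  change ∫ x, φ x * densM g x ∂(tvM g) = _
  unfold tvM
  rw [integral_sum_dirac (by simp), ← tsum_subtype_eq_of_support_subset (s := Function.support g)]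
  · refine tsum_congr fun x => ?_
    have hx : g x ≠ 0 := x.2
    have hx' : (‖g x‖ : ℂ) ≠ 0 := by simpa using hx
    simp only [densM, if_neg hx, toReal_enorm, Complex.real_smul]
    field_simp
  · intro x hx
    contrapose! hx
    simp only [Function.mem_support, not_not] at hx ⊢
    simp [hx]

lemma mkM_atom (x : ℝ) : (mkM g hg).atom x = g x := by
  unfold CMeasure.atom
  have : (mkM g hg).tv {x} = ‖g x‖ₑ := by
    change tvM g {x} = _
    rw [tvM_apply g (measurableSet_singleton x), tsum_singleton x (fun x => ‖g x‖ₑ)]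
  rw [this, toReal_enorm]
  change ‖g x‖ • densM g x = _
  unfold densM
  split_ifs with h
  · simp [h]
  · have hx' : (‖g x‖ : ℂ) ≠ 0 := by simpa using h
    rw [Complex.real_smul]; field_simp

lemma mkM_lfs : (mkM g hg).LocallyFiniteSupport := ⟨Function.support g, hg, tvM_compl g hg⟩

lemma mkM_pp : (mkM g hg).IsPurePoint := ⟨Function.support g, hg.countable, tvM_compl g hg⟩

end MK

section LP

lemma uc_periodic (F : ℝ → ℂ) (hF : Continuous F) (Q : ℕ) (hQ : 0 < Q)
    (hper : Function.Periodic F (Q:ℝ)) : UniformContinuous F := by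
  have : Fact ((0:ℝ) < Q) := ⟨by exact_mod_cast hQ⟩
  have h1 : Continuous (hper.lift : AddCircle (Q:ℝ) → ℂ) := continuous_coinduced_dom.mpr hF
  have h2 := CompactSpace.uniformContinuous_of_continuous h1
  have h3 : UniformContinuous (QuotientAddGroup.mk' (AddSubgroup.zmultiples (Q:ℝ))) :=
    uniformContinuous_addMonoidHom_of_continuous (AddCircle.continuous_mk' (Q:ℝ))
  exact h2.comp h3

lemma relDense_of_mul (T : ℕ) (hT : 0 < T) (A : Set ℝ) (h : ∀ m : ℤ, (m * T : ℝ) ∈ A) :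
    IsRelativelyDense A := by
  refine ⟨T, fun x => ⟨_, h ⌊x / T⌋, ?_⟩⟩
  have hT' : (0:ℝ) < T := by exact_mod_cast hT
  have h1 := Int.floor_le (x / T)
  have h2 := Int.lt_floor_add_one (x / T)
  rw [le_div_iff₀ hT'] at h1
  rw [div_lt_iff₀ hT'] at h2
  rw [Real.dist_eq, abs_le]
  constructor <;> nlinarith

lemma periodic_prod {G : Type*} (F : ℕ → ℝ → G) (Q : ℕ → ℕ)
    (hper : ∀ n, Function.Periodic (F n) (Q n : ℝ)) (N n : ℕ) (hn : n < N) (m : ℤ) (x : ℝ) :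
    F n (x - m * ((∏ i ∈ Finset.range N, Q i : ℕ) : ℝ)) = F n x := by
  obtain ⟨c, hc⟩ := Finset.dvd_prod_of_mem Q (Finset.mem_range.2 hn)
  rw [hc]
  have := (hper n).int_mul (m * c)
  have h2 := this.sub_eq x
  rw [← h2]
  congr 1
  push_cast
  ring

lemma bohr_of_sum (F : ℕ → ℝ → ℂ) (hc : ∀ n, Continuous (F n)) (Q : ℕ → ℕ) (hQ : ∀ n, 0 < Q n)
    (hper : ∀ n, Function.Periodic (F n) (Q n : ℝ)) (a : ℕ → ℝ) (ha : Summable a)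
    (hb : ∀ n x, ‖F n x‖ ≤ a n) : IsBohrAP (fun x => ∑' n, F n x) := by
  have hs : ∀ x, Summable (fun n => F n x) := fun x => Summable.of_norm_bounded ha (fun n => hb n x)
  have ha0 : ∀ n, 0 ≤ a n := fun n => (norm_nonneg _).trans (hb n 0)
  refine ⟨?_, ⟨∑' n, a n, fun x => tsum_of_norm_bounded ha.hasSum (fun n => hb n x)⟩, ?_⟩
  · have h1 := tendstoUniformly_tsum_nat ha hb
    refine h1.uniformContinuous (Filter.Eventually.frequently (Filter.Eventually.of_forall fun N => ?_))
    induction N with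
    | zero => simpa using uniformContinuous_const
    | succ N ih =>
      simp only [Finset.sum_range_succ]
      exact ih.add (uc_periodic _ (hc N) _ (hQ N) (hper N))
  · intro ε hε
    have h1 := tendsto_sum_nat_add a
    obtain ⟨N, hN⟩ := (h1.eventually (gt_mem_nhds (show (0:ℝ) < ε / 2 by positivity))).exists
    refine relDense_of_mul (∏ i ∈ Finset.range N, Q i) (Finset.prod_pos fun i _ => hQ i) _ ?_
    intro m x
    dsimp only
    rw [← (hs _).sum_add_tsum_nat_add N, ← (hs x).sum_add_tsum_nat_add N]
    have h2 : ∑ i ∈ Finset.range N, F i (x - m * ((∏ i ∈ Finset.range N, Q i : ℕ) : ℝ))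
        = ∑ i ∈ Finset.range N, F i x :=
      Finset.sum_congr rfl fun i hi => periodic_prod F Q hper N i (Finset.mem_range.1 hi) m x
    rw [h2, add_sub_add_left_eq_sub]
    have ha' : HasSum (fun n => a (n + N)) (∑' n, a (n + N)) :=
      ((summable_nat_add_iff N).2 ha).hasSum
    refine (norm_sub_le _ _).trans_lt ?_
    have h3 := tsum_of_norm_bounded ha' (fun n => hb (n + N) x)
    have h4 := tsum_of_norm_bounded ha' (fun n => hb (n + N)
      (x - m * ((∏ i ∈ Finset.range N, Q i : ℕ) : ℝ)))
    linarith

/-- bump weight -/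
def BB (x : ℝ) : ℝ := (1 + x ^ 2)⁻¹

lemma BB_pos (x : ℝ) : 0 < BB x := by unfold BB; positivity

lemma BB_peetre (u v : ℝ) : BB u ≤ 2 * (1 + v ^ 2) * BB (u + v) := by
  unfold BB
  rw [← div_eq_mul_inv, inv_eq_one_div, div_le_div_iff₀ (by positivity) (by positivity)]
  nlinarith [sq_nonneg (u - v), mul_nonneg (sq_nonneg u) (sq_nonneg v)]

lemma BB_neg (u : ℝ) : BB (-u) = BB u := by simp [BB]

lemma BB_int_summable : Summable (fun j : ℤ => BB j) := by
  have h : Summable (fun j : ℤ => |(j:ℝ)| ^ (-2:ℝ)) := Real.summable_abs_int_rpow (by norm_num)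
  refine Summable.of_norm_bounded_eventually (g := fun j : ℤ => |(j:ℝ)| ^ (-2:ℝ)) h ?_
  have : {(0:ℤ)}ᶜ ∈ (Filter.cofinite : Filter ℤ) := (Set.finite_singleton _).compl_mem_cofinite
  filter_upwards [this] with j hj
  have hj' : (j:ℝ) ≠ 0 := by exact_mod_cast hj
  rw [Real.norm_of_nonneg (BB_pos _).le, Real.rpow_neg (abs_nonneg _)]
  have : |(j:ℝ)| ^ (2:ℝ) = (j:ℝ)^2 := by rw [Real.rpow_two, sq_abs]
  rw [this]
  unfold BB
  have : 0 < (j:ℝ)^2 := by positivity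
  exact inv_anti₀ this (by linarith)

lemma BB_C0 : ∃ C : ℝ, 0 < C ∧ ∀ x : ℝ, ∑' j : ℤ, ENNReal.ofReal (BB (j - x)) ≤ ENNReal.ofReal C := by
  refine ⟨4 * ∑' j : ℤ, BB j, ?_, fun x => ?_⟩
  · have := BB_int_summable.tsum_pos (fun j => (BB_pos _).le) 0 (BB_pos _)
    positivity
  · rw [← (Equiv.addRight ⌊x⌋).tsum_eq]
    have h1 : ∀ j : ℤ, ENNReal.ofReal (BB (((Equiv.addRight ⌊x⌋) j : ℤ) - x))
        ≤ ENNReal.ofReal (4 * BB j) := by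
      intro j
      refine ENNReal.ofReal_le_ofReal ?_
      have h := BB_peetre (j + ⌊x⌋ - x) (x - ⌊x⌋)
      have e : (j + ⌊x⌋ - x + (x - ⌊x⌋) : ℝ) = j := by ring
      rw [e] at h
      have h0 := Int.fract_nonneg x
      have h2 := (Int.fract_lt_one x).le
      rw [← Int.self_sub_floor] at h0 h2
      simp only [Equiv.coe_addRight]
      push_cast
      refine h.trans ?_
      have : (x - ⌊x⌋)^2 ≤ 1 := by nlinarith
      have := BB_pos j
      nlinarith
    refine (ENNReal.tsum_le_tsum h1).trans ?_
    rw [← ENNReal.ofReal_tsum_of_nonneg (fun j => by have := BB_pos j; positivity)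
      (BB_int_summable.mul_left 4), tsum_mul_left]

end LP

section FAM

/-- A family of atomic measures with summable weighted norms. -/
structure Fam (S : ℕ → ℝ → ℂ) (b : ℕ → ℝ) : Prop where
  hb : Summable b
  hb0 : ∀ n, 0 ≤ b n
  key : ∀ n x, ∑' y, ‖S n y‖ₑ * ENNReal.ofReal (BB (y - x)) ≤ ENNReal.ofReal (b n)

variable {S : ℕ → ℝ → ℂ} {b : ℕ → ℝ} (hS : Fam S b)

include hS

lemma fam_phi (φ : ℝ → ℂ) (C : ℝ) (hC : 0 ≤ C) (x : ℝ) (hφ : ∀ y, ‖φ y‖ ≤ C * BB (y - x)) (n : ℕ) :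
    ∑' y, ‖φ y * S n y‖ₑ ≤ ENNReal.ofReal (C * b n) := by
  have : ∀ y, ‖φ y * S n y‖ₑ ≤ ENNReal.ofReal C * (‖S n y‖ₑ * ENNReal.ofReal (BB (y - x))) := by
    intro y
    rw [enorm_mul, mul_comm ‖S n y‖ₑ, ← mul_assoc, ← ENNReal.ofReal_mul hC]
    gcongr
    rw [← ofReal_norm]
    exact ENNReal.ofReal_le_ofReal (hφ y)
  refine (ENNReal.tsum_le_tsum this).trans ?_
  rw [ENNReal.tsum_mul_left, ENNReal.ofReal_mul hC]
  gcongr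
  exact hS.key n x

lemma fam_summable_prod (φ : ℝ → ℂ) (C : ℝ) (hC : 0 ≤ C) (x : ℝ)
    (hφ : ∀ y, ‖φ y‖ ≤ C * BB (y - x)) : Summable (fun p : ℕ × ℝ => φ p.2 * S p.1 p.2) := by
  have h1 : ∑' p : ℕ × ℝ, ‖φ p.2 * S p.1 p.2‖ₑ ≠ ∞ := by
    rw [ENNReal.tsum_prod (f := fun n y => ‖φ y * S n y‖ₑ)]
    refine ne_top_of_le_ne_top ?_ (ENNReal.tsum_le_tsum (fam_phi hS φ C hC x hφ))
    rw [← ENNReal.ofReal_tsum_of_nonneg (fun n => mul_nonneg hC (hS.hb0 n)) (hS.hb.mul_left C)]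
    exact ENNReal.ofReal_ne_top
  exact Summable.of_nnnorm (ENNReal.tsum_coe_ne_top_iff_summable.1 h1)

lemma fam_swap (φ : ℝ → ℂ) (C : ℝ) (hC : 0 ≤ C) (x : ℝ)
    (hφ : ∀ y, ‖φ y‖ ≤ C * BB (y - x)) :
    ∑' y, φ y * (∑' n, S n y) = ∑' n, ∑' y, φ y * S n y := by
  have h := fam_summable_prod hS φ C hC x hφ
  rw [← h.tsum_prod, ← (Equiv.prodComm ℝ ℕ).tsum_eq, Summable.tsum_prod]
  · simp [tsum_mul_left]
  · exact (Equiv.prodComm ℝ ℕ).summable_iff.2 h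

lemma fam_summable (φ : ℝ → ℂ) (C : ℝ) (hC : 0 ≤ C) (x : ℝ)
    (hφ : ∀ y, ‖φ y‖ ≤ C * BB (y - x)) :
    Summable (fun y => φ y * (∑' n, S n y)) := by
  have h := fam_summable_prod hS φ C hC x hφ
  have h2 : Summable (fun p : ℝ × ℕ => φ p.1 * S p.2 p.1) := (Equiv.prodComm ℝ ℕ).summable_iff.2 h
  have h3 := h2.prod
  simpa [tsum_mul_left] using h3

lemma fam_summable_n (φ : ℝ → ℂ) (C : ℝ) (hC : 0 ≤ C) (x : ℝ)
    (hφ : ∀ y, ‖φ y‖ ≤ C * BB (y - x)) (n : ℕ) : Summable (fun y => φ y * S n y) :=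
  (fam_summable_prod hS φ C hC x hφ).prod_factor n

lemma fam_bound (φ : ℝ → ℂ) (C : ℝ) (hC : 0 ≤ C) (x : ℝ)
    (hφ : ∀ y, ‖φ y‖ ≤ C * BB (y - x)) (n : ℕ) : ‖∑' y, φ y * S n y‖ ≤ C * b n := by
  have h := fam_phi hS φ C hC x hφ n
  have h2 : ‖∑' y, φ y * S n y‖ₑ ≤ ENNReal.ofReal (C * b n) :=
    (enorm_tsum_le_tsum_enorm).trans h
  rw [← ofReal_norm, ENNReal.ofReal_le_ofReal_iff (mul_nonneg hC (hS.hb0 n))] at h2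
  exact h2

lemma fam_norm_summable (n : ℕ) (x : ℝ) : Summable (fun y => BB (y - x) * ‖S n y‖) := by
  have h := (fam_summable_n hS (fun y => (BB (y - x) : ℂ)) 1 zero_le_one x (fun y => by
    rw [Complex.norm_real, Real.norm_of_nonneg (BB_pos _).le, one_mul]) n).norm
  refine h.congr fun y => ?_
  rw [norm_mul, Complex.norm_real, Real.norm_of_nonneg (BB_pos _).le]

/-- total bound -/
lemma fam_total (φ : ℝ → ℂ) (C : ℝ) (hC : 0 ≤ C) (x : ℝ)
    (hφ : ∀ y, ‖φ y‖ ≤ C * BB (y - x)) : ‖∑' y, φ y * (∑' n, S n y)‖ ≤ C * ∑' n, b n := by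
  rw [fam_swap hS φ C hC x hφ, ← tsum_mul_left]
  exact tsum_of_norm_bounded (hS.hb.mul_left C).hasSum (fam_bound hS φ C hC x hφ)

lemma fam_tv (x : ℝ) : ∑' y, ‖∑' n, S n y‖ₑ * ENNReal.ofReal (BB (y - x))
    ≤ ENNReal.ofReal (∑' n, b n) := by
  calc _ ≤ ∑' y, ∑' n, ‖S n y‖ₑ * ENNReal.ofReal (BB (y - x)) := by
        refine ENNReal.tsum_le_tsum fun y => ?_
        rw [ENNReal.tsum_mul_right]
        gcongr
        exact enorm_tsum_le_tsum_enorm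
    _ = ∑' n, ∑' y, ‖S n y‖ₑ * ENNReal.ofReal (BB (y - x)) := ENNReal.tsum_comm
    _ ≤ ∑' n, ENNReal.ofReal (b n) := ENNReal.tsum_le_tsum fun n => hS.key n x
    _ = _ := (ENNReal.ofReal_tsum_of_nonneg hS.hb0 hS.hb).symm

lemma fam_bohr (Q : ℕ → ℕ) (hQ : ∀ n, 0 < Q n) (hper : ∀ n, Function.Periodic (S n) (Q n : ℝ))
    (φ : ℝ → ℂ) (hφc : Continuous φ) (C : ℝ) (hC : 0 ≤ C) (hφ : ∀ y, ‖φ y‖ ≤ C * BB y) :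
    IsBohrAP (fun x => ∑' y, φ (x - y) * (∑' n, S n y)) := by
  have hφ' : ∀ x y, ‖φ (x - y)‖ ≤ C * BB (y - x) := by
    intro x y
    rw [← BB_neg, neg_sub]; exact hφ _
  have e : (fun x => ∑' y, φ (x - y) * (∑' n, S n y)) =
      fun x => ∑' n, ∑' y, φ (x - y) * S n y :=
    funext fun x => fam_swap hS _ C hC x (hφ' x)
  rw [e]
  refine bohr_of_sum _ ?_ Q hQ ?_ _ (hS.hb.mul_left C) (fun n x => fam_bound hS _ C hC x (hφ' x) n)
  · intro n
    rw [continuous_iff_continuousAt]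
    intro x0
    have : ContinuousOn (fun x => ∑' y, φ (x - y) * S n y) (Metric.ball x0 1) := by
      refine continuousOn_tsum (u := fun y => 4 * C * (BB (y - x0) * ‖S n y‖)) ?_
        ((fam_norm_summable hS n x0).mul_left _) ?_
      · intro y; fun_prop
      · intro y x hx
        rw [norm_mul, ← mul_assoc]
        gcongr
        refine (hφ' x y).trans ?_
        have h1 := BB_peetre (y - x) (x - x0)
        rw [sub_add_sub_cancel] at h1
        rw [Metric.mem_ball, Real.dist_eq] at hx
        have h2 : (x - x0)^2 ≤ 1 := by rw [← sq_abs]; nlinarith [abs_nonneg (x - x0)]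
        have h3 : BB (y - x) ≤ 4 * BB (y - x0) := by
          have := BB_pos (y - x0)
          nlinarith
        nlinarith
    exact this.continuousAt (Metric.ball_mem_nhds x0 one_pos)
  · intro n x
    dsimp only
    rw [← (Equiv.addRight (Q n : ℝ)).tsum_eq]
    refine tsum_congr fun y => ?_
    simp only [Equiv.coe_addRight]
    rw [hper n y, add_sub_add_right_eq_sub]

lemma fam_bohr2 (P : ℕ → ℕ) (hP : ∀ n, 0 < P n)
    (hsupp : ∀ n y, S n y ≠ 0 → ∃ j : ℤ, P n * y = j)
    (ψ : ℝ → ℂ) (C : ℝ) (hC : 0 ≤ C) (hψ : ∀ y, ‖ψ y‖ ≤ C * BB y) :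
    IsBohrAP (fun x => ∑' y, (ee (x * y) * ψ y) * (∑' n, S n y)) := by
  have hφ' : ∀ x y, ‖ee (x * y) * ψ y‖ ≤ C * BB (y - 0) := by
    intro x y
    rw [norm_mul, norm_ee, one_mul, sub_zero]; exact hψ y
  have e : (fun x => ∑' y, (ee (x * y) * ψ y) * (∑' n, S n y)) =
      fun x => ∑' n, ∑' y, (ee (x * y) * ψ y) * S n y :=
    funext fun x => fam_swap hS _ C hC 0 (hφ' x)
  rw [e]
  refine bohr_of_sum _ ?_ P hP ?_ _ (hS.hb.mul_left C) (fun n x => fam_bound hS _ C hC 0 (hφ' x) n)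
  · intro n
    refine continuous_tsum (u := fun y => C * (BB (y - 0) * ‖S n y‖)) ?_
        ((fam_norm_summable hS n 0).mul_left _) ?_
    · intro y
      have := continuous_ee
      fun_prop
    · intro y x
      rw [norm_mul, ← mul_assoc]
      gcongr
      exact hφ' x y
  · intro n x
    refine tsum_congr fun y => ?_
    by_cases h : S n y = 0
    · simp [h]
    · obtain ⟨j, hj⟩ := hsupp n y h
      rw [add_mul, ee_add, hj, ee_int, mul_one]

lemma fam_normAP (Q : ℕ → ℕ) (hQ : ∀ n, 0 < Q n) (hper : ∀ n, Function.Periodic (S n) (Q n : ℝ))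
    (hfin : ∀ y, Summable (fun n => S n y)) (ε : ℝ) (hε : 0 < ε) :
    IsRelativelyDense {t : ℝ | ∀ x : ℝ,
        (∑' z : ↥(Set.Icc x (x + 1)), (‖(∑' n, S n (z : ℝ)) - (∑' n, S n ((z : ℝ) - t))‖₊ : ℝ≥0∞)) <
          ENNReal.ofReal ε} := by
  have h1 := tendsto_sum_nat_add b
  obtain ⟨N, hN⟩ := (h1.eventually (gt_mem_nhds (show (0:ℝ) < ε / 4 by positivity))).exists
  refine relDense_of_mul (∏ i ∈ Finset.range N, Q i) (Finset.prod_pos fun i _ => hQ i) _ ?_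
  intro m x
  set t := (m * ((∏ i ∈ Finset.range N, Q i : ℕ) : ℝ)) with ht
  have hloc : ∀ (n : ℕ) (x : ℝ), ∑' z : ↥(Set.Icc x (x + 1)), ‖S n z‖ₑ ≤ 2 * ENNReal.ofReal (b n) := by
    intro n x
    calc _ ≤ ∑' z : ↥(Set.Icc x (x + 1)), 2 * (‖S n z‖ₑ * ENNReal.ofReal (BB (z - x))) := by
          refine ENNReal.tsum_le_tsum fun z => ?_
          have : 1 ≤ 2 * ENNReal.ofReal (BB (z - x)) := by
            have h2 : (2 : ℝ≥0∞) = ENNReal.ofReal 2 := by simp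
            rw [h2, ← ENNReal.ofReal_mul (by norm_num), ENNReal.one_le_ofReal]
            have hz := z.2
            rw [Set.mem_Icc] at hz
            unfold BB
            rw [← div_eq_mul_inv, le_div_iff₀ (by positivity)]
            nlinarith
          calc ‖S n z‖ₑ = ‖S n z‖ₑ * 1 := (mul_one _).symm
            _ ≤ ‖S n z‖ₑ * (2 * ENNReal.ofReal (BB (z - x))) := by gcongr
            _ = _ := by ring
      _ = 2 * ∑' z : ↥(Set.Icc x (x + 1)), (‖S n z‖ₑ * ENNReal.ofReal (BB (z - x))) :=
          ENNReal.tsum_mul_left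
      _ ≤ 2 * ∑' z, (‖S n z‖ₑ * ENNReal.ofReal (BB (z - x))) := by
          gcongr
          exact ENNReal.tsum_comp_le_tsum_of_injective Subtype.val_injective
            (fun z : ℝ => (‖S n z‖ₑ * ENNReal.ofReal (BB (z - x))))
      _ ≤ _ := by gcongr; exact hS.key n x
  have hloc2 : ∀ n, ∑' z : ↥(Set.Icc x (x + 1)), ‖S n (z - t)‖ₑ ≤ 2 * ENNReal.ofReal (b n) := by
    intro n
    have := hloc n (x - t)
    refine le_trans ?_ this
    let f : ↥(Set.Icc x (x + 1)) → ↥(Set.Icc (x - t) (x - t + 1)) := fun z =>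
      ⟨z - t, by have := z.2; rw [Set.mem_Icc] at this ⊢; constructor <;> linarith⟩
    have hf : Function.Injective f := by
      intro a c h
      have := congrArg Subtype.val h
      simp only [f, sub_left_inj] at this
      exact Subtype.ext this
    exact ENNReal.tsum_comp_le_tsum_of_injective hf (fun z => ‖S n z‖ₑ)
  have hdiff : ∀ z : ℝ, ‖(∑' n, S n z) - (∑' n, S n (z - t))‖ₑ ≤
      ∑' n, (‖S (n + N) z‖ₑ + ‖S (n + N) (z - t)‖ₑ) := by
    intro z
    rw [← (hfin z).sum_add_tsum_nat_add N, ← (hfin (z - t)).sum_add_tsum_nat_add N]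
    have h2 : ∑ i ∈ Finset.range N, S i (z - t) = ∑ i ∈ Finset.range N, S i z :=
      Finset.sum_congr rfl fun i hi => periodic_prod S Q hper N i (Finset.mem_range.1 hi) m z
    rw [h2, add_sub_add_left_eq_sub, ENNReal.tsum_add]
    refine (enorm_sub_le).trans ?_
    gcongr <;> exact enorm_tsum_le_tsum_enorm
  calc _ ≤ ∑' z : ↥(Set.Icc x (x + 1)), ∑' n, (‖S (n + N) z‖ₑ + ‖S (n + N) (z - t)‖ₑ) :=
        ENNReal.tsum_le_tsum fun z => hdiff z
    _ = ∑' n, ∑' z : ↥(Set.Icc x (x + 1)), (‖S (n + N) z‖ₑ + ‖S (n + N) (z - t)‖ₑ) :=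
        ENNReal.tsum_comm
    _ ≤ ∑' n, ENNReal.ofReal (4 * b (n + N)) := by
        refine ENNReal.tsum_le_tsum fun n => ?_
        rw [ENNReal.tsum_add]
        refine (add_le_add (hloc _ _) (hloc2 _)).trans (le_of_eq ?_)
        rw [ENNReal.ofReal_mul (by norm_num), ← add_mul]
        congr 1
        norm_num
    _ = ENNReal.ofReal (4 * ∑' n, b (n + N)) := by
        rw [← tsum_mul_left, ENNReal.ofReal_tsum_of_nonneg]
        · intro n; have := hS.hb0 (n + N); positivity
        · exact ((summable_nat_add_iff N).2 hS.hb).mul_left 4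
    _ < ENNReal.ofReal ε := by
        rw [ENNReal.ofReal_lt_ofReal_iff hε]; linarith

end FAM

section CONC

open scoped FourierTransform

lemma schwartz_bound (φ : 𝓢(ℝ, ℂ)) (y : ℝ) :
    ‖φ y‖ ≤ (2 ^ 2 * ((Finset.Iic ((2, 0) : ℕ × ℕ)).sup
      (schwartzSeminormFamily ℂ ℝ ℂ)) φ) * BB y := by
  have h := SchwartzMap.one_add_le_sup_seminorm_apply (𝕜 := ℂ) (m := (2, 0)) (k := 2) (n := 0)
    le_rfl le_rfl φ y
  rw [norm_iteratedFDeriv_zero] at h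
  unfold BB
  rw [← div_eq_mul_inv, le_div_iff₀ (by positivity)]
  refine le_trans ?_ h
  rw [mul_comm]
  gcongr
  rw [Real.norm_eq_abs]
  nlinarith [sq_abs y, abs_nonneg y]

lemma schwartz_bound' (φ : 𝓢(ℝ, ℂ)) : ∃ C : ℝ, 0 ≤ C ∧ ∀ y, ‖φ y‖ ≤ C * BB y :=
  ⟨_, by positivity, schwartz_bound φ⟩

lemma fourierInv_transRefl (ψ : 𝓢(ℝ, ℂ)) (x y : ℝ) :
    (𝓕⁻ (transRefl x ψ)) y = ee (x * y) * (𝓕 ψ) y := by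
  rw [SchwartzMap.fourierInv_coe, SchwartzMap.fourier_coe, Real.fourierInv_eq_fourier_neg,
    Real.fourier_real_eq_integral_exp_smul, Real.fourier_real_eq_integral_exp_smul,
    ← integral_const_mul]
  rw [← integral_sub_left_eq_self _ _ x]
  congr 1
  ext v
  rw [transRefl_apply, sub_sub_cancel, smul_eq_mul, smul_eq_mul, ← mul_assoc]
  congr 1
  unfold ee
  rw [← Complex.exp_add]
  push_cast
  ring_nf

lemma poisson_aux (φ : 𝓢(ℝ, ℂ)) (P : ℕ) (hP : 0 < P) (x : ℝ) :
    ∑' j : ℤ, ((P:ℂ)⁻¹ * ((𝓕⁻ φ) (j / P) * ee (-(x * (j / P))))) = ∑' m : ℤ, φ (x + P * m) := by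
  have hP' : (P:ℝ) ≠ 0 := by positivity
  let g : 𝓢(ℝ, ℂ) := SchwartzMap.compCLMOfContinuousLinearEquiv ℂ
    (ContinuousLinearEquiv.unitsEquivAut ℝ (Units.mk0 (P:ℝ) hP')) φ
  have hg : ∀ y, g y = φ (y * P) := fun y => rfl
  have h := SchwartzMap.tsum_eq_tsum_fourier g (x / P)
  have e1 : ∀ m : ℤ, g (x / P + m) = φ (x + P * m) := by
    intro m; rw [hg]; congr 1; field_simp
  simp only [e1] at h
  rw [h, ← (Equiv.neg ℤ).tsum_eq]
  refine tsum_congr fun j => ?_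
  have e2 : (𝓕 g) (j:ℝ) = (P:ℂ)⁻¹ * (𝓕⁻ φ) (((Equiv.neg ℤ) j : ℤ) / P) := by
    rw [SchwartzMap.fourierInv_coe, SchwartzMap.fourier_coe, Real.fourierInv_eq_fourier_neg,
      Real.fourier_real_eq_integral_exp_smul, Real.fourier_real_eq_integral_exp_smul]
    have := Measure.integral_comp_mul_right (fun v : ℝ => Complex.exp (↑(-2 * Real.pi * v *
      (-((((Equiv.neg ℤ) j : ℤ) : ℝ) / P))) * I) • φ v) (P:ℝ)
    rw [abs_inv, abs_of_pos (by positivity)] at this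
    rw [Complex.real_smul] at this
    push_cast at this ⊢
    rw [← this]
    congr 1
    ext v
    rw [hg]
    congr 3
    simp only [Equiv.neg_apply]
    have hPc : (P:ℂ) ≠ 0 := by exact_mod_cast hP'
    push_cast
    field_simp
  rw [e2, fourier_coe_apply, mul_assoc]
  congr 3
  unfold ee
  congr 1
  simp only [Equiv.neg_apply]
  push_cast
  ring

lemma lf_of_lattice (g : ℝ → ℂ) (D : ℕ) (hD : 0 < D) (h : ∀ y, g y ≠ 0 → ∃ j : ℤ, D * y = j) :
    LF g := by
  intro K hK
  obtain ⟨R, hR⟩ := hK.isBounded.subset_closedBall 0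
  have hD' : (0:ℝ) < D := by exact_mod_cast hD
  refine Set.Finite.subset ((Set.finite_Icc (-⌈D * R⌉) ⌈D * R⌉).image
    (fun j : ℤ => (j:ℝ) / D)) ?_
  rintro y ⟨hy, hyK⟩
  obtain ⟨j, hj⟩ := h y hy
  have h1 := hR hyK
  rw [mem_closedBall_zero_iff, Real.norm_eq_abs, abs_le] at h1
  have h2 := Int.le_ceil (D * R)
  refine ⟨j, Set.mem_Icc.2 ⟨?_, ?_⟩, ?_⟩
  · have : (-⌈D * R⌉ : ℝ) ≤ j := by rw [← hj]; nlinarith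
    exact_mod_cast this
  · have : (j : ℝ) ≤ ⌈D * R⌉ := by rw [← hj]; nlinarith
    exact_mod_cast this
  · simp only []
    rw [← hj]; field_simp

lemma lf_sum (g : ℕ → ℝ → ℂ) (h : ∀ n, LF (g n)) (h2 : ∀ n y, g n y ≠ 0 → n < |y|) :
    LF (fun y => ∑' n, g n y) := by
  intro K hK
  obtain ⟨R, hR⟩ := hK.isBounded.subset_closedBall 0
  refine Set.Finite.subset (Set.Finite.biUnion (Finset.range ⌈R⌉₊).finite_toSet
    (fun n _ => h n K hK)) ?_
  rintro y ⟨hy, hyK⟩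
  have : ∃ n, g n y ≠ 0 := by
    by_contra! hc
    exact hy (by simp [hc])
  obtain ⟨n, hn⟩ := this
  have h1 := hR hyK
  rw [mem_closedBall_zero_iff, Real.norm_eq_abs] at h1
  simp only [Set.mem_iUnion]
  refine ⟨n, ?_, hn, hyK⟩
  rw [Finset.mem_coe, Finset.mem_range, Nat.lt_ceil]
  exact (h2 n y hn).trans_le h1

lemma summable_of_far (g : ℕ → ℝ → ℂ) (h2 : ∀ n y, g n y ≠ 0 → n < |y|) (y : ℝ) :
    Summable (fun n => g n y) := by
  refine summable_of_ne_finset_zero (s := Finset.range ⌈|y|⌉₊) fun n hn => ?_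
  by_contra hc
  exact hn (Finset.mem_range.2 (Nat.lt_ceil.2 (h2 n y hc)))

lemma tsum_lattice (F : ℝ → ℂ) (e : ℤ → ℝ) (he : Function.Injective e)
    (h : ∀ y, F y ≠ 0 → ∃ j, e j = y) : ∑' y, F y = ∑' j, F (e j) :=
  (he.tsum_eq (f := F) (fun y hy => h y hy)).symm

end CONC

section FINAL

open scoped FourierTransform

/-- the period on the physical side -/
def PP (n : ℕ) : ℕ := 2 ^ (n + 1)

/-- weights -/
def cc (n : ℕ) : ℝ := (1 / 2) ^ n / PP n

lemma PP_pos (n : ℕ) : 0 < PP n := by unfold PP; positivity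

lemma PP_pos' (n : ℕ) : (0:ℝ) < PP n := by exact_mod_cast PP_pos n

lemma cc_pos (n : ℕ) : 0 < cc n := by have := PP_pos' n; unfold cc; positivity

/-- target mass -/
def AA (n : ℕ) : ℝ := (2 ^ n + 1) ^ n * (n + 1) / cc n

/-- the period on the Fourier side -/
def qq (n : ℕ) : ℕ := (w_exists (n * PP n) (PP n) (AA n)).choose

lemma qq_pos (n : ℕ) : 0 < qq n := (w_exists (n * PP n) (PP n) (AA n)).choose_spec.1

lemma qq_pos' (n : ℕ) : (0:ℝ) < qq n := by exact_mod_cast qq_pos n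

/-- the Rudin-Shapiro type weights -/
def ww (n : ℕ) : ℕ → ℂ := (w_exists (n * PP n) (PP n) (AA n)).choose_spec.2.choose

lemma ww_bound (n : ℕ) (j : ℤ) :
    ‖∑ i ∈ Finset.range (qq n), ww n i * ee (-(i * j / (qq n * PP n) : ℝ))‖ ≤ 1 :=
  (w_exists (n * PP n) (PP n) (AA n)).choose_spec.2.choose_spec.1 j

lemma ww_zero (n : ℕ) (j : ℤ) (hj : |j| ≤ (n * PP n : ℕ)) :
    ∑ i ∈ Finset.range (qq n), ww n i * ee (-(i * j / (qq n * PP n) : ℝ)) = 0 :=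
  (w_exists (n * PP n) (PP n) (AA n)).choose_spec.2.choose_spec.2.1 j hj

lemma ww_mass (n : ℕ) : AA n ≤ ∑ i ∈ Finset.range (qq n), ‖ww n i‖ :=
  (w_exists (n * PP n) (PP n) (AA n)).choose_spec.2.choose_spec.2.2

/-- the points -/
def xx (n i : ℕ) : ℝ := 2 ^ n + i / qq n

open Classical in
/-- Fourier side -/
def SF (n : ℕ) (y : ℝ) : ℂ := if ∃ j : ℤ, PP n * y = j then
  (cc n : ℂ) * ((PP n : ℂ)⁻¹ * ∑ i ∈ Finset.range (qq n), ww n i * ee (-(xx n i * y))) else 0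

open Classical in
/-- Physical side -/
def GF (n : ℕ) (x : ℝ) : ℂ := (cc n : ℂ) * ∑ i ∈ Finset.range (qq n), ww n i *
  (if ∃ m : ℤ, xx n i + PP n * m = x then 1 else 0)

lemma SF_supp (n : ℕ) (y : ℝ) (h : SF n y ≠ 0) : ∃ j : ℤ, PP n * y = j := by
  by_contra hc
  exact h (by unfold SF; rw [if_neg hc])

lemma SF_eq (n : ℕ) (j : ℤ) : SF n (j / PP n) = (cc n : ℂ) * ((PP n : ℂ)⁻¹ *
    ∑ i ∈ Finset.range (qq n), ww n i * ee (-(xx n i * (j / PP n)))) := by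
  unfold SF
  rw [if_pos]
  exact ⟨j, by have := (PP_pos' n).ne'; field_simp⟩

lemma SF_eq' (n : ℕ) (j : ℤ) : SF n (j / PP n) = (cc n : ℂ) * ((PP n : ℂ)⁻¹ *
    (ee (-(2 ^ n * (j / PP n))) *
      ∑ i ∈ Finset.range (qq n), ww n i * ee (-(i * j / (qq n * PP n) : ℝ)))) := by
  rw [SF_eq, Finset.mul_sum (a := ee _)]
  congr 2
  refine Finset.sum_congr rfl fun i _ => ?_
  have : -(xx n i * (j / PP n)) = -(2 ^ n * (j / PP n)) + (-(i * j / (qq n * PP n) : ℝ)) := by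
    unfold xx
    have := (PP_pos' n).ne'
    have := (qq_pos' n).ne'
    field_simp
    ring
  rw [this, ee_add]; ring

lemma eq_div_PP {n : ℕ} {y : ℝ} {j : ℤ} (h : PP n * y = j) : (j:ℝ) / PP n = y := by
  rw [← h]; have := (PP_pos' n).ne'; field_simp

lemma SF_bound (n : ℕ) (j : ℤ) : ‖SF n (j / PP n)‖ ≤ cc n / PP n := by
  rw [SF_eq', norm_mul, norm_mul, norm_mul, norm_ee, one_mul, Complex.norm_real,
    Real.norm_of_nonneg (cc_pos n).le, norm_inv, Complex.norm_natCast, div_eq_mul_inv]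
  have := ww_bound n j
  have := cc_pos n
  have := PP_pos' n
  refine mul_le_mul_of_nonneg_left ?_ (by positivity)
  refine mul_le_of_le_one_right (by positivity) (ww_bound n j)

lemma SF_far (n : ℕ) (y : ℝ) (h : SF n y ≠ 0) : n < |y| := by
  obtain ⟨j, hj⟩ := SF_supp n y h
  by_contra! hc
  apply h
  rw [← eq_div_PP hj, SF_eq', ww_zero, mul_zero, mul_zero, mul_zero]
  have : |(j:ℝ)| ≤ n * PP n := by
    rw [← hj, abs_mul, abs_of_pos (PP_pos' n), mul_comm]
    have := PP_pos' n
    gcongr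
  exact_mod_cast this

lemma div_PP_inj (n : ℕ) : Function.Injective (fun j : ℤ => (j:ℝ) / PP n) := by
  intro a c h
  have := (PP_pos' n).ne'
  simp only [] at h
  field_simp at h
  exact_mod_cast h

lemma BB_scale (P : ℝ) (hP : 1 ≤ P) (u : ℝ) : BB (u / P) ≤ P ^ 2 * BB u := by
  unfold BB
  rw [← div_eq_mul_inv, inv_eq_one_div, div_le_div_iff₀ (by positivity) (by positivity), div_pow]
  have : 0 < P := by linarith
  have h : P ^ 2 * (1 + u ^ 2 / P ^ 2) = P ^ 2 + u ^ 2 := by field_simp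
  rw [h]; nlinarith

lemma SF_fam : ∃ b, Fam SF b := by
  obtain ⟨C, hC, h⟩ := BB_C0
  refine ⟨fun n => C * (1 / 2) ^ n, summable_geometric_two.mul_left C, fun n => by positivity, ?_⟩
  intro n x
  have e : ∑' y, ‖SF n y‖ₑ * ENNReal.ofReal (BB (y - x)) =
      ∑' j : ℤ, ‖SF n (j / PP n)‖ₑ * ENNReal.ofReal (BB (j / PP n - x)) := by
    refine ((div_PP_inj n).tsum_eq (f := fun y => ‖SF n y‖ₑ * ENNReal.ofReal (BB (y - x))) ?_).symm
    intro y hy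
    have : SF n y ≠ 0 := by
      intro h0; simp [h0] at hy
    obtain ⟨j, hj⟩ := SF_supp n y this
    exact ⟨j, eq_div_PP hj⟩
  rw [e]
  have h1 : ∀ j : ℤ, ‖SF n (j / PP n)‖ₑ * ENNReal.ofReal (BB (j / PP n - x))
      ≤ ENNReal.ofReal ((1 / 2) ^ n) * ENNReal.ofReal (BB (j - PP n * x)) := by
    intro j
    rw [← ofReal_norm, ← ENNReal.ofReal_mul (norm_nonneg _), ← ENNReal.ofReal_mul (by positivity)]
    refine ENNReal.ofReal_le_ofReal ?_
    have hp := PP_pos' n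
    have h2 := BB_scale (PP n) (by exact_mod_cast PP_pos n) (j - PP n * x)
    have e2 : ((j:ℝ) - PP n * x) / PP n = j / PP n - x := by field_simp
    rw [e2] at h2
    calc _ ≤ (cc n / PP n) * (PP n ^ 2 * BB (j - PP n * x)) :=
          mul_le_mul (SF_bound n j) h2 (BB_pos _).le (by have := cc_pos n; positivity)
      _ = _ := by unfold cc; field_simp
  refine (ENNReal.tsum_le_tsum h1).trans ?_
  rw [ENNReal.tsum_mul_left, mul_comm C, ENNReal.ofReal_mul (by positivity)]
  gcongr
  exact h _

lemma SF_per (n : ℕ) : Function.Periodic (SF n) (qq n : ℝ) := by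
  intro y
  unfold SF
  have e1 : (∃ j : ℤ, PP n * (y + qq n) = j) ↔ ∃ j : ℤ, PP n * y = j := by
    constructor
    · rintro ⟨j, hj⟩
      refine ⟨j - PP n * qq n, ?_⟩
      push_cast; rw [← hj]; ring
    · rintro ⟨j, hj⟩
      refine ⟨j + PP n * qq n, ?_⟩
      push_cast; rw [← hj]; ring
  have e2 : ∀ i, ee (-(xx n i * (y + qq n))) = ee (-(xx n i * y)) := by
    intro i
    have : -(xx n i * (y + qq n)) = -(xx n i * y) + ((-(2 ^ n * qq n + i) : ℤ) : ℝ) := by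
      unfold xx
      have := (qq_pos' n).ne'
      push_cast
      field_simp
      ring
    rw [this, ee_add, ee_int, mul_one]
  simp only [e2]
  by_cases h : ∃ j : ℤ, PP n * y = j
  · rw [if_pos (e1.2 h), if_pos h]
  · rw [if_neg (fun h2 => h (e1.1 h2)), if_neg h]

lemma SF_lf (n : ℕ) : LF (SF n) := lf_of_lattice _ (PP n) (PP_pos n) (SF_supp n)

lemma GF_supp (n : ℕ) (x : ℝ) (h : GF n x ≠ 0) : ∃ i < qq n, ∃ m : ℤ, xx n i + PP n * m = x := by
  by_contra! hc
  apply h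
  unfold GF
  rw [Finset.sum_eq_zero, mul_zero]
  intro i hi
  rw [if_neg, mul_zero]
  rintro ⟨m, hm⟩
  exact hc i (Finset.mem_range.1 hi) m hm

lemma xx_lattice (n i : ℕ) (m : ℤ) : ∃ j : ℤ, qq n * (xx n i + PP n * m) = j := by
  refine ⟨qq n * 2 ^ n + i + qq n * PP n * m, ?_⟩
  unfold xx
  have := (qq_pos' n).ne'
  push_cast
  field_simp

lemma GF_lf (n : ℕ) : LF (GF n) := by
  refine lf_of_lattice _ (qq n) (qq_pos n) ?_
  intro y hy
  obtain ⟨i, _, m, rfl⟩ := GF_supp n y hy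
  exact xx_lattice n i m

lemma xx_floor (n i : ℕ) (hi : i < qq n) (m : ℤ) :
    ⌊xx n i + PP n * m⌋ = 2 ^ n * (1 + 2 * m) := by
  rw [Int.floor_eq_iff]
  have h1 : (0:ℝ) ≤ i / qq n := by positivity
  have h2 : (i:ℝ) / qq n < 1 := by
    rw [div_lt_one (qq_pos' n)]; exact_mod_cast hi
  unfold xx PP
  push_cast
  rw [pow_succ]
  constructor <;> nlinarith

lemma GF_far (n : ℕ) (x : ℝ) (h : GF n x ≠ 0) : n < |x| := by
  obtain ⟨i, hi, m, hm⟩ := GF_supp n x h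
  have hf := xx_floor n i hi m
  rw [hm] at hf
  have h1 := Int.floor_le x
  have h2 := Int.lt_floor_add_one x
  rw [hf] at h1 h2
  have h3 : (n:ℝ) + 1 ≤ 2 ^ n := by
    have : n < 2 ^ n := Nat.lt_two_pow_self
    exact_mod_cast this
  push_cast at h1 h2
  rcases le_or_gt 0 m with hm0 | hm0
  · have : (0:ℝ) ≤ m := by exact_mod_cast hm0
    refine lt_of_lt_of_le ?_ (le_abs_self x)
    nlinarith
  · have : (m:ℝ) ≤ -1 := by exact_mod_cast Int.le_sub_one_of_lt hm0
    refine lt_of_lt_of_le ?_ (neg_le_abs x)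
    nlinarith

lemma GF_at (n i : ℕ) (hi : i < qq n) : ∑' l, GF l (xx n i) = cc n * ww n i := by
  have hf := xx_floor n i hi 0
  simp only [Int.cast_zero, mul_zero, add_zero, mul_one] at hf
  rw [tsum_eq_single n]
  · unfold GF
    rw [Finset.sum_eq_single i]
    · rw [if_pos ⟨0, by simp⟩, mul_one]
    · intro i' hi' hne
      rw [if_neg, mul_zero]
      rintro ⟨m, hm⟩
      have hf' := xx_floor n i' (Finset.mem_range.1 hi') m
      rw [hm, hf] at hf'
      have hpos : (2:ℤ) ^ n ≠ 0 := by positivity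
      have : 1 + 2 * m = 1 := by
        apply mul_left_cancel₀ hpos; rw [← hf', mul_one]
      have hm0 : m = 0 := by omega
      subst hm0
      simp only [Int.cast_zero, mul_zero, add_zero, xx, add_right_inj] at hm
      have := (qq_pos' n).ne'
      field_simp at hm
      exact hne (by exact_mod_cast hm)
    · intro h; exact absurd (Finset.mem_range.2 hi) h
  · intro l hl
    by_contra hc
    obtain ⟨i', hi', m, hm⟩ := GF_supp l _ hc
    have hf' := xx_floor l i' hi' m
    rw [hm, hf] at hf'
    rcases lt_or_gt_of_ne hl with h | h
    · obtain ⟨d, rfl⟩ := Nat.exists_eq_add_of_lt h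
      have hpos : (2:ℤ) ^ l ≠ 0 := by positivity
      have : (2:ℤ) ^ l * (2 * 2 ^ d) = 2 ^ l * (1 + 2 * m) := by
        rw [← hf']; ring
      have := mul_left_cancel₀ hpos this
      omega
    · obtain ⟨d, rfl⟩ := Nat.exists_eq_add_of_lt h
      have hpos : (2:ℤ) ^ n ≠ 0 := by positivity
      have : (2:ℤ) ^ n * 1 = 2 ^ n * (2 * (2 ^ d * (1 + 2 * m))) := by
        rw [mul_one]; exact hf'.trans (by ring)
      have := mul_left_cancel₀ hpos this
      omega

/-- total Fourier side atoms -/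
def SS (y : ℝ) : ℂ := ∑' n, SF n y

/-- total physical side atoms -/
def GG (y : ℝ) : ℂ := ∑' n, GF n y

lemma SS_lf : LF SS := lf_sum _ SF_lf SF_far
lemma GG_lf : LF GG := lf_sum _ GF_lf GF_far

/-- the tempered distribution of the Fourier side measure -/
def TS : 𝓢(ℝ, ℂ) →L[ℂ] ℂ :=
  SchwartzMap.mkCLMtoNormedSpace (σ := RingHom.id ℂ) (fun φ => ∑' y, φ y * SS y)
    (by
      intro f g
      obtain ⟨b, hb⟩ := SF_fam
      obtain ⟨C, hC, hf⟩ := schwartz_bound' f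
      obtain ⟨D, hD, hg⟩ := schwartz_bound' g
      rw [← Summable.tsum_add]
      · simp [add_mul]
      · exact fam_summable hb f C hC 0 (by simpa using hf)
      · exact fam_summable hb g D hD 0 (by simpa using hg))
    (by
      intro a f
      simp [mul_assoc, tsum_mul_left])
    (by
      obtain ⟨b, hb⟩ := SF_fam
      refine ⟨Finset.Iic (2, 0), 2 ^ 2 * ∑' n, b n, ?_, ?_⟩
      · have : 0 ≤ ∑' n, b n := tsum_nonneg hb.hb0
        positivity
      · intro f
        have := fam_total hb f (2 ^ 2 * ((Finset.Iic ((2, 0) : ℕ × ℕ)).sup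
          (schwartzSeminormFamily ℂ ℝ ℂ)) f) (by positivity) 0 (by simpa using schwartz_bound f)
        refine this.trans (le_of_eq (by ring)))

lemma TS_apply (φ : 𝓢(ℝ, ℂ)) : TS φ = ∑' y, φ y * SS y := rfl

/-- the tempered distribution of the physical side measure -/
def TG : 𝓢(ℝ, ℂ) →L[ℂ] ℂ :=
  TS.comp ((FourierTransform.fourierCLE ℂ 𝓢(ℝ, ℂ)).symm : 𝓢(ℝ, ℂ) →L[ℂ] 𝓢(ℝ, ℂ))

lemma TG_apply (φ : 𝓢(ℝ, ℂ)) : TG φ = TS (𝓕⁻ φ) := rfl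

lemma fourierTD_TG : fourierTD TG = TS := by
  ext φ
  change TS (𝓕⁻ (𝓕 φ)) = TS φ
  rw [FourierTransform.fourierInv_fourier_eq]

lemma summable_test {g : ℝ → ℂ} (hg : LF g) (φ : ℝ → ℂ) (hφ : HasCompactSupport φ) :
    Summable (fun x => φ x * g x) := by
  have hf := hg _ hφ
  refine summable_of_ne_finset_zero (s := hf.toFinset) fun x hx => ?_
  by_contra hc
  apply hx
  rw [Set.Finite.mem_toFinset]
  exact ⟨right_ne_zero_of_mul hc, subset_closure (left_ne_zero_of_mul hc)⟩

lemma pair_SF (n : ℕ) (φ : 𝓢(ℝ, ℂ)) : ∑' y, (𝓕⁻ φ : 𝓢(ℝ, ℂ)) y * SF n y =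
    cc n * ∑ i ∈ Finset.range (qq n), ww n i * ∑' m : ℤ, φ (xx n i + PP n * m) := by
  rw [tsum_lattice _ (fun j : ℤ => (j:ℝ) / PP n) (div_PP_inj n)]
  · simp only [SF_eq, ← poisson_aux φ (PP n) (PP_pos n)]
    obtain ⟨C, hC, hb⟩ := schwartz_bound' (𝓕⁻ φ)
    have hs : ∀ i, Summable (fun j : ℤ => ((PP n:ℂ)⁻¹ * ((𝓕⁻ φ) (j / PP n) *
        ee (-(xx n i * (j / PP n)))))) := by
      intro i
      refine Summable.mul_left _ ?_
      refine Summable.of_norm_bounded ((BB_int_summable.mul_left ((PP n : ℝ) ^ 2)).mul_left C) ?_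
      intro j
      rw [norm_mul, norm_ee, mul_one]
      refine (hb _).trans ?_
      gcongr
      exact BB_scale _ (by exact_mod_cast PP_pos n) _
    have e : ∀ j : ℤ, (𝓕⁻ φ) (j / PP n) * (cc n * ((PP n : ℂ)⁻¹ *
        ∑ i ∈ Finset.range (qq n), ww n i * ee (-(xx n i * (j / PP n))))) =
        cc n * ∑ i ∈ Finset.range (qq n), ww n i * ((PP n:ℂ)⁻¹ * ((𝓕⁻ φ) (j / PP n) *
          ee (-(xx n i * (j / PP n))))) := by
      intro j
      simp only [Finset.mul_sum]
      refine Finset.sum_congr rfl fun i _ => ?_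
      ring
    rw [tsum_congr e, tsum_mul_left, Summable.tsum_finsetSum (fun i _ => (hs i).mul_left _)]
    simp only [tsum_mul_left]
  · intro y hy
    obtain ⟨j, hj⟩ := SF_supp n y (right_ne_zero_of_mul hy)
    exact ⟨j, eq_div_PP hj⟩

open Classical in
lemma pair_GF (n : ℕ) (φ : ℝ → ℂ) (hφ : HasCompactSupport φ) : ∑' y, φ y * GF n y =
    cc n * ∑ i ∈ Finset.range (qq n), ww n i * ∑' m : ℤ, φ (xx n i + PP n * m) := by
  let u : ℕ → ℝ → ℂ := fun i x => if ∃ m : ℤ, xx n i + PP n * m = x then 1 else 0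
  have hu : ∀ i x, u i x ≠ 0 → ∃ m : ℤ, xx n i + PP n * m = x := by
    intro i x h
    by_contra hc
    exact h (if_neg hc)
  have hlf : ∀ i, LF (u i) := by
    intro i
    refine lf_of_lattice _ (qq n) (qq_pos n) fun y hy => ?_
    obtain ⟨m, rfl⟩ := hu i y hy
    exact xx_lattice n i m
  have e : ∀ y, φ y * GF n y = cc n * ∑ i ∈ Finset.range (qq n), ww n i * (φ y * u i y) := by
    intro y
    simp only [GF, Finset.mul_sum]
    refine Finset.sum_congr rfl fun i _ => ?_
    simp only [u]
    ring
  rw [tsum_congr e, tsum_mul_left,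
    Summable.tsum_finsetSum (fun i _ => (summable_test (hlf i) φ hφ).mul_left _)]
  congr 1
  refine Finset.sum_congr rfl fun i _ => ?_
  rw [tsum_mul_left, tsum_lattice _ (fun m : ℤ => xx n i + PP n * m)]
  · congr 1
    refine tsum_congr fun m => ?_
    have : u i (xx n i + PP n * m) = 1 := if_pos ⟨m, rfl⟩
    rw [this, mul_one]
  · intro a c h
    have := (PP_pos' n).ne'
    simp only [add_right_inj] at h
    exact_mod_cast mul_left_cancel₀ this h
  · intro y hy
    exact hu i y (right_ne_zero_of_mul hy)

lemma agrees_G : (mkM GG GG_lf).Agrees TG := by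
  intro φ hφ
  obtain ⟨b, hb⟩ := SF_fam
  obtain ⟨C, hC, hbd⟩ := schwartz_bound' (𝓕⁻ φ)
  unfold CMeasure.pairing
  rw [mkM_integral, TG_apply, TS_apply]
  unfold SS
  rw [fam_swap hb (⇑(𝓕⁻ φ : 𝓢(ℝ, ℂ))) C hC 0 (by simpa using hbd)]
  have e : ∀ n, ∑' y, (𝓕⁻ φ : 𝓢(ℝ, ℂ)) y * SF n y = ∑' y, φ y * GF n y := by
    intro n; rw [pair_SF, pair_GF n φ hφ]
  rw [tsum_congr e]
  obtain ⟨R, hR⟩ := (IsCompact.isBounded hφ).subset_closedBall 0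
  have hz : ∀ n, n ∉ Finset.range ⌈R⌉₊ → ∀ y, φ y * GF n y = 0 := by
    intro n hn y
    by_contra hc
    apply hn
    have h1 := GF_far n y (right_ne_zero_of_mul hc)
    have h2 := hR (subset_closure (left_ne_zero_of_mul hc))
    rw [mem_closedBall_zero_iff, Real.norm_eq_abs] at h2
    exact Finset.mem_range.2 (Nat.lt_ceil.2 (h1.trans_le h2))
  rw [tsum_eq_sum (s := Finset.range ⌈R⌉₊) (fun n hn => by simp [hz n hn]),
    ← Summable.tsum_finsetSum (fun n _ => summable_test (GF_lf n) φ hφ)]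
  refine tsum_congr fun y => ?_
  unfold GG
  rw [← tsum_mul_left, tsum_eq_sum (s := Finset.range ⌈R⌉₊) (fun n hn => hz n hn y)]

lemma agrees_S : (mkM SS SS_lf).Agrees TS := by
  intro φ _
  unfold CMeasure.pairing
  rw [mkM_integral, TS_apply]

lemma sapm_S : (mkM SS SS_lf).SAPM := by
  intro φ hc hs
  obtain ⟨b, hb⟩ := SF_fam
  have e : (mkM SS SS_lf).convM φ = fun x => ∑' y, φ (x - y) * ∑' n, SF n y := by
    funext x
    unfold CMeasure.convM
    rw [mkM_integral SS_lf (fun y => φ (x - y))]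
    rfl
  rw [e]
  have hc2 : Continuous (fun y => ((1 + y ^ 2 : ℝ) : ℂ) * φ y) := by fun_prop
  obtain ⟨C, hC⟩ := hc2.bounded_above_of_compact_support hs.mul_left
  have hC0 : 0 ≤ C := (norm_nonneg _).trans (hC 0)
  refine fam_bohr hb qq qq_pos SF_per φ hc C hC0 fun y => ?_
  have h1 := hC y
  have hp : (0:ℝ) < 1 + y ^ 2 := by positivity
  rw [norm_mul, Complex.norm_real, Real.norm_of_nonneg hp.le] at h1
  unfold BB
  rw [← div_eq_mul_inv, le_div_iff₀ hp]
  linarith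

lemma saptd_S : SAPTD TS := by
  intro ψ
  obtain ⟨b, hb⟩ := SF_fam
  obtain ⟨C, hC, hbd⟩ := schwartz_bound' ψ
  exact fam_bohr hb qq qq_pos SF_per ψ ψ.continuous C hC hbd

lemma saptd_G : SAPTD TG := by
  intro ψ
  obtain ⟨b, hb⟩ := SF_fam
  obtain ⟨C, hC, hbd⟩ := schwartz_bound' (𝓕 ψ)
  have e : convTD TG ψ = fun x => ∑' y, (ee (x * y) * (𝓕 ψ) y) * (∑' n, SF n y) := by
    funext x
    unfold convTD
    rw [TG_apply, TS_apply]
    simp only [fourierInv_transRefl]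
    rfl
  rw [e]
  exact fam_bohr2 hb PP PP_pos SF_supp _ C hC hbd

lemma st_S : (mkM SS SS_lf).IsStronglyTempered := by
  obtain ⟨b, hb⟩ := SF_fam
  have hb0 : 0 ≤ ∑' n, b n := tsum_nonneg hb.hb0
  refine ⟨2 * ∑' n, b n, 2, fun r hr => ?_⟩
  change tvM SS _ ≤ _
  rw [tvM_apply _ Metric.isClosed_closedBall.measurableSet]
  calc _ ≤ ∑' z : ↥(Metric.closedBall (0:ℝ) r), ENNReal.ofReal (2 * r ^ 2) *
          (‖SS z‖ₑ * ENNReal.ofReal (BB (z - 0))) := by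
        refine ENNReal.tsum_le_tsum fun z => ?_
        have hz := z.2
        rw [mem_closedBall_zero_iff, Real.norm_eq_abs] at hz
        have : 1 ≤ ENNReal.ofReal (2 * r ^ 2) * ENNReal.ofReal (BB (z - 0)) := by
          rw [← ENNReal.ofReal_mul (by positivity), ENNReal.one_le_ofReal, sub_zero]
          unfold BB
          rw [← div_eq_mul_inv, le_div_iff₀ (by positivity), ← sq_abs (z : ℝ)]
          nlinarith [abs_nonneg (z : ℝ)]
        calc ‖SS z‖ₑ = 1 * ‖SS z‖ₑ := (one_mul _).symm
          _ ≤ (ENNReal.ofReal (2 * r ^ 2) * ENNReal.ofReal (BB (z - 0))) * ‖SS z‖ₑ := by gcongr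
          _ = _ := by ring
    _ = ENNReal.ofReal (2 * r ^ 2) * ∑' z : ↥(Metric.closedBall (0:ℝ) r),
          (‖SS z‖ₑ * ENNReal.ofReal (BB (z - 0))) := ENNReal.tsum_mul_left
    _ ≤ ENNReal.ofReal (2 * r ^ 2) * ∑' z, (‖SS z‖ₑ * ENNReal.ofReal (BB (z - 0))) := by
        gcongr
        exact ENNReal.tsum_comp_le_tsum_of_injective Subtype.val_injective
            (fun z : ℝ => (‖SS z‖ₑ * ENNReal.ofReal (BB (z - 0))))
    _ ≤ ENNReal.ofReal (2 * r ^ 2) * ENNReal.ofReal (∑' n, b n) := by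
        gcongr
        exact fam_tv hb 0
    _ = _ := by
        rw [← ENNReal.ofReal_mul (by positivity), Real.rpow_two]
        congr 1; ring

lemma nst_G : ¬ (mkM GG GG_lf).IsStronglyTempered := by
  rintro ⟨C, a, h⟩
  obtain ⟨n, hn⟩ := exists_nat_gt (max C a)
  have hnC : C < n := (le_max_left _ _).trans_lt hn
  have hna : a < n := (le_max_right _ _).trans_lt hn
  have hr1 : (1:ℝ) ≤ 2 ^ n + 1 := by
    have : (0:ℝ) < 2 ^ n := by positivity
    linarith
  have h1 := h (2 ^ n + 1) hr1
  change tvM GG _ ≤ _ at h1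
  rw [tvM_apply _ Metric.isClosed_closedBall.measurableSet] at h1
  have hmem : ∀ i : Fin (qq n), xx n i ∈ Metric.closedBall (0:ℝ) (2 ^ n + 1) := by
    intro i
    have h2 : ((i:ℕ):ℝ) / qq n < 1 := by
      rw [div_lt_one (qq_pos' n)]; exact_mod_cast i.2
    rw [mem_closedBall_zero_iff, Real.norm_eq_abs, abs_of_nonneg (by unfold xx; positivity)]
    unfold xx
    linarith
  let f : Fin (qq n) → ↥(Metric.closedBall (0:ℝ) (2 ^ n + 1)) := fun i => ⟨xx n i, hmem i⟩
  have hf : Function.Injective f := by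
    intro i j hij
    have := congrArg Subtype.val hij
    simp only [f, xx, add_right_inj] at this
    have hq := (qq_pos' n).ne'
    field_simp at this
    exact Fin.ext (by exact_mod_cast this)
  have h2 := (ENNReal.tsum_comp_le_tsum_of_injective hf (fun z => ‖GG z‖ₑ)).trans h1
  have h3 : ∑' i : Fin (qq n), ‖GG (f i)‖ₑ =
      ENNReal.ofReal (cc n * ∑ i ∈ Finset.range (qq n), ‖ww n i‖) := by
    rw [tsum_fintype, Finset.mul_sum, ENNReal.ofReal_sum_of_nonneg
      (fun i _ => mul_nonneg (cc_pos n).le (norm_nonneg _)), ← Fin.sum_univ_eq_sum_range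
      (fun i => ENNReal.ofReal (cc n * ‖ww n i‖))]
    refine Finset.sum_congr rfl fun i _ => ?_
    change ‖GG (xx n i)‖ₑ = _
    unfold GG
    rw [GF_at n i i.2, ← ofReal_norm, norm_mul, Complex.norm_real,
      Real.norm_of_nonneg (cc_pos n).le]
  rw [h3] at h2
  have h4 : (2 ^ n + 1 : ℝ) ^ n * (n + 1) ≤ cc n * ∑ i ∈ Finset.range (qq n), ‖ww n i‖ := by
    have := mul_le_mul_of_nonneg_left (ww_mass n) (cc_pos n).le
    refine le_trans (le_of_eq ?_) this
    unfold AA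
    have := (cc_pos n).ne'
    field_simp
  have h5 : C * (2 ^ n + 1 : ℝ) ^ a < (2 ^ n + 1 : ℝ) ^ n * (n + 1) := by
    have h6 : (2 ^ n + 1 : ℝ) ^ a ≤ (2 ^ n + 1 : ℝ) ^ n := by
      rw [← Real.rpow_natCast (2 ^ n + 1 : ℝ) n]
      exact Real.rpow_le_rpow_of_exponent_le hr1 hna.le
    have h7 : 0 < (2 ^ n + 1 : ℝ) ^ a := Real.rpow_pos_of_pos (by linarith) _
    have h8 : (0:ℝ) ≤ n := by positivity
    nlinarith
  have h9 := (ENNReal.ofReal_le_ofReal h4).trans h2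
  rw [← not_lt] at h9
  exact h9 ((ENNReal.ofReal_lt_ofReal_iff (by positivity)).2 h5)

end FINAL

/-- There is a crystalline measure `σ` on `ℝ` that is not a Fourier
quasicrystal: `σ̂ = Σ` with `Σ` a translation-bounded (hence strongly tempered) measure
that is norm almost periodic (hence strongly almost periodic as a tempered distribution
and as a measure), while `σ` is a tempered measure that is not strongly tempered but is
strongly almost periodic (hence translation bounded) as a tempered distribution. -/
theorem exists_crystalline_not_fourierQuasicrystal :
    ∃ (σ Sm : CMeasure ℝ) (T : SchwartzMap ℝ ℂ →L[ℂ] ℂ),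
      σ.Agrees T ∧ Sm.Agrees (fourierTD T) ∧
      σ.IsPurePoint ∧ Sm.IsPurePoint ∧
      σ.LocallyFiniteSupport ∧ Sm.LocallyFiniteSupport ∧
      -- (a)
      Sm.TransBddM ∧ Sm.IsStronglyTempered ∧
      -- (b)
      ¬ σ.IsStronglyTempered ∧
      -- (d)
      SAPTD T ∧ TransBddTD T ∧
      -- (e) norm almost periodicity of Σ
      (∀ ε : ℝ, 0 < ε → IsRelativelyDense {t : ℝ | ∀ x : ℝ,
        (∑' z : ↥(Set.Icc x (x + 1)), (‖Sm.atom (z : ℝ) - Sm.atom ((z : ℝ) - t)‖₊ : ℝ≥0∞)) <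
          ENNReal.ofReal ε}) ∧
      SAPTD (fourierTD T) ∧ Sm.SAPM := by
  refine ⟨mkM GG GG_lf, mkM SS SS_lf, TG, agrees_G, ?_, mkM_pp _, mkM_pp _, mkM_lfs _, mkM_lfs _,
    fun φ hc hs => (sapm_S φ hc hs).2.1, st_S, nst_G, saptd_G, fun ψ => (saptd_G ψ).2.1, ?_, ?_,
    sapm_S⟩
  · rw [fourierTD_TG]; exact agrees_S
  · intro ε hε
    obtain ⟨b, hb⟩ := SF_fam
    simp only [mkM_atom]
    exact fam_normAP hb qq qq_pos SF_per (summable_of_far SF SF_far) ε hε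
  · rw [fourierTD_TG]; exact saptd_S
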